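/- If 0 < β < 1/(σ·√(2π)), then for every α ∈ ℝ there exist real numbers μ_l < μ_h such that for every μ ∈ ℝ: (a) if μ < μ_l or μ > μ_h then S(α, β, μ, σ) has exactly one element; (b) if μ_l < μ < μ_h then S(α, β, μ, σ) has exactly three elements; (c) if μ = μ_l or μ = μ_h then S(α, β, μ, σ) has exactly two elements. -/

import Mathlib

open Real MeasureTheory

/-- The standard normal cumulative distribution function
`Φ(z) = (1/√(2π)) ∫_{−∞}^{z} exp(−t²/2) dt`. -/
noncomputable def stdNormalCDF (z : ℝ) : ℝ :=
  (Real.sqrt (2 * Real.pi))⁻¹ * ∫ t in Set.Iic z, Real.exp (-t ^ 2 / 2)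

/-- The equilibrium solution set `S(α, β, μ, σ) = {θ : α + β·θ = Φ((θ − μ)/σ)}`. -/
def S (α β μ σ : ℝ) : Set ℝ :=
  {θ : ℝ | α + β * θ = stdNormalCDF ((θ - μ) / σ)}

/-- The level sets of a continuous function which decreases from `+∞` to a local minimum at `p`,
increases up to a local maximum at `q`, and then decreases to `-∞`. -/
theorem ncard_level_set_of_strictAntiOn_strictMonoOn_strictAntiOn {g : ℝ → ℝ} {p q : ℝ}
    (hpq : p < q) (hg : Continuous g) (hl : StrictAntiOn g (Set.Iic p))
    (hm : StrictMonoOn g (Set.Icc p q)) (hr : StrictAntiOn g (Set.Ici q))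
    (hbot : Filter.Tendsto g Filter.atBot Filter.atTop)
    (htop : Filter.Tendsto g Filter.atTop Filter.atBot) (k : ℝ) :
    ((k < g p ∨ k > g q) → {x | g x = k}.ncard = 1) ∧
    (g p < k → k < g q → {x | g x = k}.ncard = 3) ∧
    ((k = g p ∨ k = g q) → {x | g x = k}.ncard = 2) := by
  have hgpq : g p < g q := hm ⟨le_rfl, hpq.le⟩ ⟨hpq.le, le_rfl⟩ hpq
  have left_lt : ∀ x, x < p → g p < g x := fun x hx => hl hx.le Set.self_mem_Iic hx
  have right_lt : ∀ x, q < x → g x < g q := fun x hx => hr Set.self_mem_Ici hx.le hx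
  have mid_gt : ∀ x, p < x → x ≤ q → g p < g x := fun x h1 h2 =>
    hm ⟨le_rfl, hpq.le⟩ ⟨h1.le, h2⟩ h1
  have mid_lt : ∀ x, p ≤ x → x < q → g x < g q := fun x h1 h2 =>
    hm ⟨h1, h2.le⟩ ⟨hpq.le, le_rfl⟩ h2
  have left_ex : g p < k → ∃ x, x < p ∧ g x = k := by
    intro h
    obtain ⟨a, ha, hap⟩ :=
      ((hbot.eventually_ge_atTop k).and (Filter.eventually_lt_atBot p)).exists
    obtain ⟨x, hx, hxk⟩ := intermediate_value_Icc' hap.le hg.continuousOn ⟨h.le, ha⟩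
    exact ⟨x, lt_of_le_of_ne hx.2 (by rintro rfl; exact h.ne hxk), hxk⟩
  have right_ex : k < g q → ∃ x, q < x ∧ g x = k := by
    intro h
    obtain ⟨a, ha, hqa⟩ :=
      ((htop.eventually_le_atBot k).and (Filter.eventually_gt_atTop q)).exists
    obtain ⟨x, hx, hxk⟩ := intermediate_value_Icc' hqa.le hg.continuousOn ⟨ha, h.le⟩
    exact ⟨x, lt_of_le_of_ne hx.1 (by rintro rfl; exact h.ne' hxk), hxk⟩
  refine ⟨?_, ?_, ?_⟩
  · rintro (h | h)
    · obtain ⟨x, hx, hxk⟩ := right_ex (h.trans hgpq)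
      refine Set.ncard_eq_one.2 ⟨x, Set.eq_singleton_iff_unique_mem.2 ⟨hxk, fun y hy => ?_⟩⟩
      have hy' : g y = k := hy
      have hqy : q < y := by
        by_contra! hyq
        rcases lt_trichotomy y p with h1 | rfl | h1
        · linarith [left_lt y h1]
        · linarith
        · linarith [mid_gt y h1 hyq]
      exact hr.injOn hqy.le hx.le (hy'.trans hxk.symm)
    · obtain ⟨x, hx, hxk⟩ := left_ex (hgpq.trans h)
      refine Set.ncard_eq_one.2 ⟨x, Set.eq_singleton_iff_unique_mem.2 ⟨hxk, fun y hy => ?_⟩⟩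
      have hy' : g y = k := hy
      have hyp : y < p := by
        by_contra! hpy
        rcases lt_trichotomy y q with h1 | rfl | h1
        · linarith [mid_lt y hpy h1]
        · linarith
        · linarith [right_lt y h1]
      exact hl.injOn hyp.le hx.le (hy'.trans hxk.symm)
  · intro h1 h2
    obtain ⟨x, hx, hxk⟩ := left_ex h1
    obtain ⟨z, hz, hzk⟩ := right_ex h2
    obtain ⟨y, hy, hyk⟩ := intermediate_value_Icc hpq.le hg.continuousOn ⟨h1.le, h2.le⟩
    have hpy : p < y := lt_of_le_of_ne hy.1 (by rintro rfl; exact h1.ne hyk)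
    have hyq : y < q := lt_of_le_of_ne hy.2 (by rintro rfl; exact h2.ne' hyk)
    refine Set.ncard_eq_three.2 ⟨x, y, z, (hx.trans hpy).ne, (hx.trans (hpq.trans hz)).ne,
      (hyq.trans hz).ne, Set.ext fun w => ⟨fun hw => ?_, ?_⟩⟩
    · have hw' : g w = k := hw
      rcases le_total w p with h | h
      · exact Or.inl (hl.injOn h hx.le (hw'.trans hxk.symm))
      rcases le_total w q with h' | h'
      · exact Or.inr (Or.inl (hm.injOn ⟨h, h'⟩ hy (hw'.trans hyk.symm)))
      · exact Or.inr (Or.inr (hr.injOn h' hz.le (hw'.trans hzk.symm)))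
    · rintro (rfl | rfl | rfl) <;> assumption
  · rintro (h | h)
    · obtain ⟨z, hz, hzk⟩ := right_ex (h.trans_lt hgpq)
      refine Set.ncard_eq_two.2 ⟨p, z, (hpq.trans hz).ne, Set.ext fun w => ⟨fun hw => ?_, ?_⟩⟩
      · have hw' : g w = k := hw
        rcases lt_trichotomy w p with h1 | rfl | h1
        · linarith [left_lt w h1]
        · exact Or.inl rfl
        rcases le_total w q with h' | h'
        · linarith [mid_gt w h1 h']
        · exact Or.inr (hr.injOn h' hz.le (hw'.trans hzk.symm))
      · rintro (rfl | rfl)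
        exacts [h.symm, hzk]
    · obtain ⟨x, hx, hxk⟩ := left_ex (hgpq.trans_eq h.symm)
      refine Set.ncard_eq_two.2 ⟨q, x, (hx.trans hpq).ne', Set.ext fun w => ⟨fun hw => ?_, ?_⟩⟩
      · have hw' : g w = k := hw
        rcases lt_trichotomy w q with h1 | rfl | h1
        · rcases le_total w p with h' | h'
          · exact Or.inr (hl.injOn h' hx.le (hw'.trans hxk.symm))
          · linarith [mid_lt w h' h1]
        · exact Or.inl rfl
        · linarith [right_lt w h1]
      · rintro (rfl | rfl)
        exacts [h.symm, hxk]

theorem integrable_exp_neg_sq_div_two : Integrable fun t : ℝ => Real.exp (-t ^ 2 / 2) := by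
  convert integrable_exp_neg_mul_sq (b := 1 / 2) (by norm_num) using 3
  ring

theorem hasDerivAt_stdNormalCDF (z : ℝ) :
    HasDerivAt stdNormalCDF ((Real.sqrt (2 * Real.pi))⁻¹ * Real.exp (-z ^ 2 / 2)) z := by
  have hcont : Continuous fun t : ℝ => Real.exp (-t ^ 2 / 2) := by fun_prop
  have hint := integrable_exp_neg_sq_div_two
  have h := intervalIntegral.integral_hasDerivAt_right (hcont.intervalIntegrable 0 z)
    (hcont.stronglyMeasurableAtFilter _ _) hcont.continuousAt
  have hIic := h.const_add (∫ t in Set.Iic 0, Real.exp (-t ^ 2 / 2))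
  refine (hIic.congr_of_eventuallyEq (.of_forall fun y => ?_)).const_mul _
  beta_reduce
  rw [← intervalIntegral.integral_Iic_sub_Iic hint.integrableOn hint.integrableOn]
  ring

theorem stdNormalCDF_nonneg (z : ℝ) : 0 ≤ stdNormalCDF z :=
  mul_nonneg (by positivity) (integral_nonneg fun _ => (Real.exp_pos _).le)

theorem stdNormalCDF_le_one (z : ℝ) : stdNormalCDF z ≤ 1 := by
  have htotal : ∫ t : ℝ, Real.exp (-t ^ 2 / 2) = Real.sqrt (2 * Real.pi) := by
    convert integral_gaussian (1 / 2) using 3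
    · ring_nf
    · ring
  have hle := setIntegral_le_integral (s := Set.Iic z) integrable_exp_neg_sq_div_two
    (.of_forall fun _ => (Real.exp_pos _).le)
  rw [htotal] at hle
  rw [stdNormalCDF, inv_mul_le_iff₀ (by positivity), mul_one]
  exact hle

/-- Subtracting a line of slope `b`, flatter than the maximal slope of the normal CDF, from the
normal CDF gives a function with three monotone branches. -/
theorem exists_ncard_level_set_stdNormalCDF_sub_mul {b : ℝ} (hb : 0 < b)
    (hb' : b * Real.sqrt (2 * Real.pi) < 1) :
    ∃ kl kh : ℝ, kl < kh ∧ ∀ k : ℝ,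
      ((k < kl ∨ k > kh) → {z | stdNormalCDF z - b * z = k}.ncard = 1) ∧
      (kl < k → k < kh → {z | stdNormalCDF z - b * z = k}.ncard = 3) ∧
      ((k = kl ∨ k = kh) → {z | stdNormalCDF z - b * z = k}.ncard = 2) := by
  have hsqrt : 0 < Real.sqrt (2 * Real.pi) := by positivity
  set L := Real.log (b * Real.sqrt (2 * Real.pi))
  have hL0 : L < 0 := Real.log_neg (by positivity) hb'
  have hexpL : Real.exp L = b * Real.sqrt (2 * Real.pi) := Real.exp_log (by positivity)
  set c := Real.sqrt (-2 * L)
  have hc0 : 0 < c := Real.sqrt_pos.2 (by linarith)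
  have hc2 : c ^ 2 = -2 * L := Real.sq_sqrt (by linarith)
  have hderiv (z : ℝ) : HasDerivAt (fun z => stdNormalCDF z - b * z)
      ((Real.sqrt (2 * Real.pi))⁻¹ * Real.exp (-z ^ 2 / 2) - b) z := by
    have h := (hasDerivAt_stdNormalCDF z).sub ((hasDerivAt_id z).const_mul b)
    rw [mul_one] at h
    exact h
  have hcont : Continuous fun z => stdNormalCDF z - b * z :=
    continuous_iff_continuousAt.2 fun z => (hderiv z).continuousAt
  have hneg (z : ℝ) (hz : c ^ 2 < z ^ 2) : deriv (fun z => stdNormalCDF z - b * z) z < 0 := by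
    rw [(hderiv z).deriv, sub_neg, inv_mul_lt_iff₀ hsqrt, mul_comm, ← hexpL, Real.exp_lt_exp]
    linarith
  have hpos (z : ℝ) (hz : z ^ 2 < c ^ 2) : 0 < deriv (fun z => stdNormalCDF z - b * z) z := by
    rw [(hderiv z).deriv, sub_pos, lt_inv_mul_iff₀ hsqrt, mul_comm, ← hexpL, Real.exp_lt_exp]
    linarith
  have hcc : -c < c := by linarith
  have hmono : StrictMonoOn (fun z => stdNormalCDF z - b * z) (Set.Icc (-c) c) := by
    refine strictMonoOn_of_deriv_pos (convex_Icc _ _) hcont.continuousOn fun z hz => hpos z ?_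
    rw [interior_Icc] at hz
    exact sq_lt_sq' hz.1 hz.2
  refine ⟨_, _, hmono ⟨le_rfl, hcc.le⟩ ⟨hcc.le, le_rfl⟩ hcc, fun k =>
    ncard_level_set_of_strictAntiOn_strictMonoOn_strictAntiOn hcc hcont ?_ hmono ?_ ?_ ?_ k⟩
  · refine strictAntiOn_of_deriv_neg (convex_Iic _) hcont.continuousOn fun z hz => hneg z ?_
    rw [interior_Iic, Set.mem_Iio] at hz
    nlinarith
  · refine strictAntiOn_of_deriv_neg (convex_Ici _) hcont.continuousOn fun z hz => hneg z ?_
    rw [interior_Ici, Set.mem_Ioi] at hz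
    nlinarith
  · refine Filter.tendsto_atTop_mono (fun z => ?_)
      (Filter.tendsto_id.const_mul_atBot_of_neg (neg_neg_of_pos hb))
    simp only [id]
    linarith [stdNormalCDF_nonneg z]
  · refine Filter.tendsto_atBot_mono (fun z => ?_) (Filter.tendsto_atBot_add_const_left _ 1
      (Filter.tendsto_id.const_mul_atTop_of_neg (neg_neg_of_pos hb)))
    simp only [id]
    linarith [stdNormalCDF_le_one z]

theorem ncard_S_eq_ncard_level_set {σ : ℝ} (hσ : 0 < σ) (α β μ : ℝ) :
    (S α β μ σ).ncard = {z | stdNormalCDF z - β * σ * z = α + β * μ}.ncard := by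
  have hS : S α β μ σ = (fun z => μ + σ * z) '' {z | stdNormalCDF z - β * σ * z = α + β * μ} := by
    ext θ
    constructor
    · intro h
      have h' : α + β * θ = stdNormalCDF ((θ - μ) / σ) := h
      refine ⟨(θ - μ) / σ, ?_, by field_simp; ring⟩
      rw [Set.mem_ofPred_eq, ← h']
      field_simp
      ring
    · rintro ⟨z, hz, rfl⟩
      have hz' : stdNormalCDF z - β * σ * z = α + β * μ := hz
      have harg : (μ + σ * z - μ) / σ = z := by field_simp; ring
      change α + β * (μ + σ * z) = stdNormalCDF ((μ + σ * z - μ) / σ)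
      rw [harg]
      linarith
  rw [hS, Set.ncard_image_of_injective]
  intro x y hxy
  exact mul_left_cancel₀ hσ.ne' (add_left_cancel hxy)

/-- If `0 < β < 1/(σ·√(2π))`, then there exist `μ_l < μ_h` such that
`S(α, β, μ, σ)` has exactly one element for `μ` outside `[μ_l, μ_h]`, exactly
three elements for `μ` strictly between `μ_l` and `μ_h`, and exactly two
elements at `μ = μ_l` or `μ = μ_h` (Lemma A.1(ii)–(iv)). -/
theorem stmt4 (β σ : ℝ) (hσ : 0 < σ)
    (hβ : 0 < β) (hβ' : β < 1 / (σ * Real.sqrt (2 * Real.pi))) :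
    ∀ α : ℝ, ∃ μl μh : ℝ, μl < μh ∧
      ∀ μ : ℝ,
        ((μ < μl ∨ μ > μh) → (S α β μ σ).ncard = 1) ∧
        (μl < μ → μ < μh → (S α β μ σ).ncard = 3) ∧
        ((μ = μl ∨ μ = μh) → (S α β μ σ).ncard = 2) := by
  intro α
  have hb' : β * σ * Real.sqrt (2 * Real.pi) < 1 := by
    rwa [lt_div_iff₀ (by positivity), ← mul_assoc] at hβ'
  obtain ⟨kl, kh, hk, H⟩ := exists_ncard_level_set_stdNormalCDF_sub_mul (mul_pos hβ hσ) hb'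
  refine ⟨(kl - α) / β, (kh - α) / β, by gcongr, fun μ => ?_⟩
  simp only [ncard_S_eq_ncard_level_set hσ, gt_iff_lt, lt_div_iff₀ hβ, div_lt_iff₀ hβ,
    eq_div_iff hβ.ne', mul_comm μ β]
  obtain ⟨h1, h2, h3⟩ := H (α + β * μ)
  refine ⟨fun h => h1 (h.imp ?_ ?_), fun h h' => h2 ?_ ?_, fun h => h3 (h.imp ?_ ?_)⟩ <;>
    intros <;> linarith
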